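/- arXiv:2009.12337 — 2 statements merged into one kernel-verified Lean document; each statement's English description precedes it below -/
import Mathlib

section
/- Let n be a positive integer and let μ be a probability measure on ℝ whose cumulative distribution function F(x) = μ((−∞,x]) is continuous and strictly increasing with range (0,1) (so F is a bijection from ℝ onto (0,1)). Let X_1,...,X_n be i.i.d. with law μ and let U_1,...,U_n be i.i.d. uniform on (0,1). Then for every subset I ⊆ {1,...,n}, the Kullback–Leibler divergence between the joint law of the order statistics (X_(i))_{i∈I} and the product of their marginal laws equals the Kullback–Leibler divergence between the joint law of (U_(i))_{i∈I} and the product of their marginal laws; in particular this divergence does not depend on μ. -/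
open MeasureTheory Real Filter Topology Classical

noncomputable section

/-- Kullback–Leibler divergence: `∫ log (dP/dQ) dP` when `P ≪ Q`, and `+∞` otherwise. -/
def klDiv {α : Type*} [MeasurableSpace α] (P Q : Measure α) : EReal :=
  if P ≪ Q then ((∫ x, Real.log ((P.rnDeriv Q x).toReal) ∂P : ℝ) : EReal) else ⊤

/-- The nondecreasing rearrangement of a tuple: `sortTuple x i` is the `i`-th order
statistic (0-indexed) of the vector `x`. -/
def sortTuple {n : ℕ} (x : Fin n → ℝ) : Fin n → ℝ := x ∘ Tuple.sort x

/-- Law of an i.i.d. sample of size `n` from `μ`. -/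
def sampleLaw (n : ℕ) (μ : Measure ℝ) : Measure (Fin n → ℝ) := Measure.pi fun _ => μ

/-- Law of the `i`-th order statistic (0-indexed) of an i.i.d. sample of size `n` from `μ`. -/
def osLaw (n : ℕ) (μ : Measure ℝ) (i : Fin n) : Measure ℝ :=
  (sampleLaw n μ).map fun x => sortTuple x i

/-- Joint law of the order statistics indexed by `I`. -/
def orderLaw (n : ℕ) (μ : Measure ℝ) (I : Finset (Fin n)) : Measure (I → ℝ) :=
  (sampleLaw n μ).map fun x (i : I) => sortTuple x i.1

/-- Product of the marginal laws of the order statistics indexed by `I`. -/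
def orderProdLaw (n : ℕ) (μ : Measure ℝ) (I : Finset (Fin n)) : Measure (I → ℝ) :=
  Measure.pi fun i : I => osLaw n μ i.1

/-- Mutual information between two tuples of order statistics. -/
def miTuples (n : ℕ) (μ : Measure ℝ) (I₁ I₂ : Finset (Fin n)) : EReal :=
  klDiv
    ((sampleLaw n μ).map fun x =>
      ((fun i : I₁ => sortTuple x i.1), (fun i : I₂ => sortTuple x i.1)))
    ((orderLaw n μ I₁).prod (orderLaw n μ I₂))

/-- Mutual information between two single order statistics (0-indexed). -/
def miPair (n : ℕ) (μ : Measure ℝ) (r m : Fin n) : EReal :=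
  klDiv ((sampleLaw n μ).map fun x => (sortTuple x r, sortTuple x m))
    ((osLaw n μ r).prod (osLaw n μ m))

/-- The uniform probability measure on `(0,1)`. -/
def unif : Measure ℝ := volume.restrict (Set.Ioo 0 1)

/-- `T r = log (r!) - r * H_r`. -/
def T (r : ℕ) : ℝ := Real.log (Nat.factorial r) - r * (harmonic r : ℝ)

theorem measurable_sortTuple_apply {n : ℕ} (i : Fin n) :
    Measurable fun x : Fin n → ℝ => sortTuple x i := by
  intro s hs
  have h : (fun x : Fin n → ℝ => sortTuple x i) ⁻¹' s
      = ⋃ σ : Equiv.Perm (Fin n), ({x | Monotone (x ∘ σ)} ∩ {x | x (σ i) ∈ s}) := by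
    ext x
    simp only [Set.mem_preimage, Set.mem_iUnion, Set.mem_inter_iff, Set.mem_setOf_eq]
    constructor
    · intro h
      exact ⟨Tuple.sort x, Tuple.monotone_sort x, h⟩
    · rintro ⟨σ, hσ, h⟩
      have := congrFun (Tuple.comp_sort_eq_comp_iff_monotone.mpr hσ) i
      simp only [sortTuple]
      simp only [Function.comp_apply] at this ⊢
      rw [← this] at *
      first | exact h | (rw [this]; exact h)
  rw [h]
  refine MeasurableSet.iUnion fun σ => MeasurableSet.inter ?_ ?_
  · have : {x : Fin n → ℝ | Monotone (x ∘ σ)}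
        = ⋂ a : Fin n, ⋂ b : Fin n, ⋂ _ : a ≤ b, {x | x (σ a) ≤ x (σ b)} := by
      ext x
      simp [Monotone]
    rw [this]
    exact MeasurableSet.iInter fun a => MeasurableSet.iInter fun b => MeasurableSet.iInter
      fun _ => measurableSet_le (measurable_pi_apply _) (measurable_pi_apply _)
  · exact measurable_pi_apply (σ i) hs

theorem sortTuple_comp {n : ℕ} {F : ℝ → ℝ} (hF : Monotone F) (x : Fin n → ℝ) :
    sortTuple (F ∘ x) = F ∘ sortTuple x := by
  have h : Monotone ((F ∘ x) ∘ Tuple.sort x) := hF.comp (Tuple.monotone_sort x)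
  have h2 := Tuple.comp_sort_eq_comp_iff_monotone.mpr h
  unfold sortTuple
  first | exact h2 | exact h2.symm

theorem klDiv_map_embedding {α β : Type*} [MeasurableSpace α] [MeasurableSpace β]
    (P Q : Measure α) [IsFiniteMeasure P] [IsFiniteMeasure Q] {f : α → β}
    (hf : MeasurableEmbedding f) : klDiv (P.map f) (Q.map f) = klDiv P Q := by
  have hac : P.map f ≪ Q.map f ↔ P ≪ Q := by
    constructor
    · intro h s hs
      have : Q.map f (f '' s) = 0 := by
        rw [hf.map_apply, Set.preimage_image_eq _ hf.injective, hs]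
      have := h this
      rwa [hf.map_apply, Set.preimage_image_eq _ hf.injective] at this
    · intro h
      exact h.map hf.measurable
  unfold klDiv
  by_cases h : P ≪ Q
  · rw [if_pos h, if_pos (hac.mpr h), hf.integral_map]
    congr 1
    refine integral_congr_ae ?_
    filter_upwards [h (hf.rnDeriv_map P Q)] with x hx
    rw [hx]
  · rw [if_neg h, if_neg (fun h' => h (hac.mp h'))]

theorem map_cdf_eq_unif (μ : Measure ℝ) [IsProbabilityMeasure μ]
    (hF : Continuous fun x => (μ (Set.Iic x)).toReal)
    (hFmono : StrictMono fun x => (μ (Set.Iic x)).toReal)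
    (hFrange : Set.range (fun x => (μ (Set.Iic x)).toReal) = Set.Ioo 0 1) :
    μ.map (fun x => (μ (Set.Iic x)).toReal) = unif := by
  have hpm : IsProbabilityMeasure (μ.map (fun x => (μ (Set.Iic x)).toReal)) :=
    Measure.isProbabilityMeasure_map hF.measurable.aemeasurable
  have hmem : ∀ x, (μ (Set.Iic x)).toReal ∈ Set.Ioo (0 : ℝ) 1 := fun x => by
    rw [← hFrange]; exact ⟨x, rfl⟩
  refine Measure.ext_of_Iic _ _ fun t => ?_
  rw [Measure.map_apply hF.measurable measurableSet_Iic, unif,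
    Measure.restrict_apply measurableSet_Iic]
  rcases le_or_gt t 0 with h0 | h0
  · have h1 : (fun x => (μ (Set.Iic x)).toReal) ⁻¹' Set.Iic t = ∅ := by
      ext x
      have := (hmem x).1
      simp only [Set.mem_preimage, Set.mem_Iic, Set.mem_empty_iff_false, iff_false, not_le]
      linarith
    have h2 : Set.Iic t ∩ Set.Ioo (0 : ℝ) 1 = ∅ := by
      ext x
      simp only [Set.mem_inter_iff, Set.mem_Iic, Set.mem_Ioo, Set.mem_empty_iff_false, iff_false]
      rintro ⟨a, b, c⟩
      linarith
    rw [h1, h2]; simp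
  rcases le_or_gt 1 t with h1 | h1
  · have e1 : (fun x => (μ (Set.Iic x)).toReal) ⁻¹' Set.Iic t = Set.univ := by
      ext x
      have := (hmem x).2
      simp only [Set.mem_preimage, Set.mem_Iic, Set.mem_univ, iff_true]
      linarith
    have e2 : Set.Iic t ∩ Set.Ioo (0 : ℝ) 1 = Set.Ioo 0 1 := by
      refine Set.inter_eq_right.mpr fun x hx => ?_
      exact hx.2.le.trans h1
    rw [e1, e2]; simp
  · have ht : t ∈ Set.range (fun x => (μ (Set.Iic x)).toReal) := by
      rw [hFrange]; exact ⟨h0, h1⟩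
    obtain ⟨a, ha⟩ := ht
    have e1 : (fun x => (μ (Set.Iic x)).toReal) ⁻¹' Set.Iic t = Set.Iic a := by
      ext x
      rw [Set.mem_preimage, Set.mem_Iic, ← ha]
      exact hFmono.le_iff_le
    have e2 : Set.Iic t ∩ Set.Ioo (0 : ℝ) 1 = Set.Ioc 0 t := by
      ext x
      simp only [Set.mem_inter_iff, Set.mem_Iic, Set.mem_Ioo, Set.mem_Ioc]
      constructor
      · rintro ⟨a, b, c⟩; exact ⟨b, a⟩
      · rintro ⟨a, b⟩; exact ⟨b, a, by linarith⟩
    rw [e1, e2, Real.volume_Ioc, sub_zero, ← ha]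
    exact (ENNReal.ofReal_toReal (measure_ne_top _ _)).symm

/-- Distribution-free property of the KL divergence between the joint law of a tuple of
order statistics and the product of its marginal laws, for sampling distributions with an
invertible (continuous, strictly increasing, range `(0,1)`) cdf. -/
theorem kl_orderStatistics_distribution_free
    (n : ℕ) (hn : 0 < n) (μ : Measure ℝ) [IsProbabilityMeasure μ]
    (hF : Continuous fun x => (μ (Set.Iic x)).toReal)
    (hFmono : StrictMono fun x => (μ (Set.Iic x)).toReal)
    (hFrange : Set.range (fun x => (μ (Set.Iic x)).toReal) = Set.Ioo 0 1)
    (I : Finset (Fin n)) :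
    klDiv (orderLaw n μ I) (orderProdLaw n μ I)
      = klDiv (orderLaw n unif I) (orderProdLaw n unif I) := by
  have hU := map_cdf_eq_unif μ hF hFmono hFrange
  set F : ℝ → ℝ := fun x => (μ (Set.Iic x)).toReal with hFdef
  have hUp : IsProbabilityMeasure unif := by
    rw [← hU]; exact Measure.isProbabilityMeasure_map hF.measurable.aemeasurable
  have hcompm : ∀ (ι : Type) [Fintype ι], Measurable fun (x : ι → ℝ) => F ∘ x := fun ι _ =>
    measurable_pi_lambda _ fun i => hF.measurable.comp (measurable_pi_apply i)
  have hS : sampleLaw n unif = (sampleLaw n μ).map (fun x => F ∘ x) := by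
    unfold sampleLaw
    have hh : ∀ _ : Fin n, SigmaFinite (μ.map F) := fun _ => by rw [hU]; infer_instance
    have := Measure.pi_map_pi (μ := fun _ : Fin n => μ) (f := fun _ => F)
      (fun _ => hF.measurable.aemeasurable)
    rw [hU] at this
    exact this.symm
  have hSp : IsProbabilityMeasure (sampleLaw n μ) := by
    unfold sampleLaw; infer_instance
  have hsm : Measurable fun x (i : I) => sortTuple (n := n) x i.1 :=
    measurable_pi_lambda _ fun i => measurable_sortTuple_apply i.1
  have hos : ∀ i, osLaw n unif i = (osLaw n μ i).map F := by
    intro i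
    unfold osLaw
    rw [hS, Measure.map_map (measurable_sortTuple_apply i) (hcompm _),
      Measure.map_map hF.measurable (measurable_sortTuple_apply i)]
    congr 1
    funext x
    exact congrFun (sortTuple_comp hFmono.monotone x) i
  have hosp : ∀ i, IsProbabilityMeasure (osLaw n μ i) := fun i =>
    Measure.isProbabilityMeasure_map (measurable_sortTuple_apply i).aemeasurable
  have hJ : orderLaw n unif I = (orderLaw n μ I).map (fun x => F ∘ x) := by
    unfold orderLaw
    rw [hS, Measure.map_map hsm (hcompm _), Measure.map_map (hcompm _) hsm]
    congr 1
    funext x i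
    exact congrFun (sortTuple_comp hFmono.monotone x) i.1
  have hP : orderProdLaw n unif I = (orderProdLaw n μ I).map (fun x => F ∘ x) := by
    unfold orderProdLaw
    have hh : ∀ i : I, SigmaFinite ((osLaw n μ i.1).map F) := fun i =>
      have := Measure.isProbabilityMeasure_map (μ := osLaw n μ i.1) hF.measurable.aemeasurable
      inferInstance
    have := Measure.pi_map_pi (μ := fun i : I => osLaw n μ i.1) (f := fun _ => F)
      (fun _ => hF.measurable.aemeasurable)
    simp only [hos]
    exact this.symm
  have hJp : IsProbabilityMeasure (orderLaw n μ I) :=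
    Measure.isProbabilityMeasure_map hsm.aemeasurable
  have hPp : IsProbabilityMeasure (orderProdLaw n μ I) := by
    unfold orderProdLaw; infer_instance
  have hemb : MeasurableEmbedding fun (x : I → ℝ) => F ∘ x := by
    refine Continuous.measurableEmbedding ?_ ?_
    · exact continuous_pi fun i => hF.comp (continuous_apply i)
    · exact hFmono.injective.comp_left
  rw [hJ, hP, klDiv_map_embedding _ _ hemb]
end
end

section
/- Let n be a positive integer, let U_1,...,U_n be i.i.d. uniform on (0,1) with order statistics U_(1) ≤ ... ≤ U_(n), and let I = {i_1 < i_2 < ... < i_k} ⊆ {1,...,n}. Then the Kullback–Leibler divergence between the joint law of (U_(i))_{i∈I} and the product of its marginal laws equals Σ_{t=2}^{k} (T_{i_t−1} − T_{i_t−i_{t−1}−1}) + Σ_{t=1}^{k−1} T_{n−i_t} − (k−1)·T_n. -/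
open MeasureTheory Real Filter Topology Classical

noncomputable section

/-- Open ordered simplex. -/
def osS (n : ℕ) (a : ℝ) : Set (Fin n → ℝ) := {x | StrictMono x ∧ ∀ i, x i ∈ Set.Ioo a 1}

lemma osS_cons (n : ℕ) (a y : ℝ) (x : Fin n → ℝ) :
    (Fin.cons y x : Fin (n+1) → ℝ) ∈ osS (n+1) a ↔ y ∈ Set.Ioo a 1 ∧ x ∈ osS n y := by
  constructor
  · rintro ⟨h1, h2⟩
    refine ⟨by simpa using h2 0, ?_, ?_⟩
    · intro i j hij
      have := h1 (Fin.succ_lt_succ_iff.2 hij)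
      simpa using this
    · intro i
      have h3 := h1 (Fin.succ_pos i)
      have h4 := h2 i.succ
      simp only [Fin.cons_zero, Fin.cons_succ] at h3 h4
      exact ⟨h3, h4.2⟩
  · rintro ⟨h1, h2, h3⟩
    refine ⟨?_, ?_⟩
    · intro i j hij
      induction i using Fin.cases with
      | zero =>
        induction j using Fin.cases with
        | zero => exact absurd hij (lt_irrefl _)
        | succ j => simpa using (h3 j).1
      | succ i =>
        induction j using Fin.cases with
        | zero => exact absurd hij (by simp)
        | succ j => simpa using h2 (Fin.succ_lt_succ_iff.1 hij)
    · intro i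
      induction i using Fin.cases with
      | zero => simpa using h1
      | succ i => simpa using ⟨h1.1.trans (h3 i).1, (h3 i).2⟩

lemma osS_meas2 (n : ℕ) : MeasurableSet {p : ℝ × (Fin n → ℝ) | p.2 ∈ osS n p.1} := by
  have : {p : ℝ × (Fin n → ℝ) | p.2 ∈ osS n p.1} =
      (⋂ i : Fin n, ⋂ j : Fin n, {p : ℝ × (Fin n → ℝ) | i < j → p.2 i < p.2 j}) ∩
      ⋂ i : Fin n, ({p : ℝ × (Fin n → ℝ) | p.1 < p.2 i} ∩ {p | p.2 i < 1}) := by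
    ext p
    simp only [osS, StrictMono, Set.mem_ofPred_eq, Set.mem_inter_iff, Set.mem_iInter, Set.mem_Ioo]
  rw [this]
  refine MeasurableSet.inter (MeasurableSet.iInter fun i => MeasurableSet.iInter fun j => ?_)
    (MeasurableSet.iInter fun i => MeasurableSet.inter ?_ ?_)
  · by_cases h : i < j
    · simp only [h, true_imp_iff]
      exact measurableSet_lt (by fun_prop) (by fun_prop)
    · simp [h]
  · exact measurableSet_lt (by fun_prop) (by fun_prop)
  · exact measurableSet_lt (by fun_prop) (by fun_prop)

lemma osS_meas (n : ℕ) (a : ℝ) : MeasurableSet (osS n a) :=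
  (osS_meas2 n).preimage (measurable_const.prodMk measurable_id : Measurable fun x => (a, x))

lemma meas_cons (n : ℕ) : Measurable fun p : ℝ × (Fin n → ℝ) => (Fin.cons p.1 p.2 : Fin (n+1) → ℝ) := by
  refine measurable_pi_lambda _ fun i => ?_
  induction i using Fin.cases with
  | zero => simpa using measurable_fst
  | succ i => simp only [Fin.cons_succ]; fun_prop

lemma lint_cons (n : ℕ) (f : (Fin (n+1) → ℝ) → ENNReal) (hf : Measurable f) :
    ∫⁻ x, f x = ∫⁻ y : ℝ, ∫⁻ x : Fin n → ℝ, f (Fin.cons y x) := by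
  have h := (volume_preserving_piFinSuccAbove (fun _ : Fin (n+1) => ℝ) 0).symm
  rw [← h.lintegral_comp hf]
  have : ∀ p : ℝ × (Fin n → ℝ), (MeasurableEquiv.piFinSuccAbove (fun _ : Fin (n+1) => ℝ) 0).symm p
      = Fin.cons p.1 p.2 := by
    intro p
    simp [MeasurableEquiv.piFinSuccAbove_symm_apply, Fin.insertNthEquiv]
  simp_rw [this]
  rw [Measure.volume_eq_prod]
  exact lintegral_prod (fun p : ℝ × (Fin n → ℝ) => f (Fin.cons p.1 p.2))
    (hf.comp (meas_cons n)).aemeasurable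

lemma lint_osS_cons (n : ℕ) (a : ℝ) (f : (Fin (n+1) → ℝ) → ENNReal) (hf : Measurable f) :
    ∫⁻ x in osS (n+1) a, f x =
      ∫⁻ y in Set.Ioo a 1, ∫⁻ x in osS n y, f (Fin.cons y x) := by
  rw [← lintegral_indicator (osS_meas _ _), lint_cons _ _ (hf.indicator (osS_meas _ _)),
    ← lintegral_indicator measurableSet_Ioo]
  refine lintegral_congr fun y => ?_
  by_cases hy : y ∈ Set.Ioo a 1
  · rw [Set.indicator_of_mem hy, ← lintegral_indicator (osS_meas _ _)]
    refine lintegral_congr fun x => ?_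
    by_cases hx : x ∈ osS n y
    · rw [Set.indicator_of_mem hx, Set.indicator_of_mem ((osS_cons n a y x).2 ⟨hy, hx⟩)]
    · rw [Set.indicator_of_notMem hx, Set.indicator_of_notMem]
      exact fun h => hx ((osS_cons n a y x).1 h).2
  · rw [Set.indicator_of_notMem hy]
    rw [lintegral_eq_zero_iff']
    · refine Eventually.of_forall fun x => ?_
      exact Set.indicator_of_notMem (fun h => hy ((osS_cons n a y x).1 h).1) _
    · exact (((hf.indicator (osS_meas _ _)).comp (meas_cons n)).comp
        (measurable_const.prodMk measurable_id : Measurable fun x => (y, x))).aemeasurable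

/-- weight -/
def osW : (k : ℕ) → (ℕ → ℕ) → ℝ → (Fin k → ℝ) → ℝ
  | 0, g, a, _ => (1 - a) ^ (g 0) / (g 0).factorial
  | k+1, g, a, u => (u 0 - a) ^ (g 0) / (g 0).factorial *
      osW k (fun t => g (t+1)) (u 0) (fun t => u t.succ)

/-- spacings -/
def osG : (k : ℕ) → ℝ → (Fin k → ℝ) → ℕ → ℝ
  | 0, a, _, _ => 1 - a
  | _+1, a, u, 0 => u 0 - a
  | k+1, _, u, t+1 => osG k (u 0) (fun t => u t.succ) t

lemma osW_meas2 (k : ℕ) : ∀ g, Measurable fun p : ℝ × (Fin k → ℝ) => osW k g p.1 p.2 := by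
  induction k with
  | zero => intro g; simp only [osW]; fun_prop
  | succ k ih =>
    intro g
    simp only [osW]
    refine Measurable.mul (by fun_prop) ?_
    exact (ih fun t => g (t+1)).comp (g := fun p : ℝ × (Fin k → ℝ) => osW k _ p.1 p.2)
      (f := fun p : ℝ × (Fin (k+1) → ℝ) => (p.2 0, fun t : Fin k => p.2 t.succ)) (by fun_prop)

lemma osW_meas (k : ℕ) (g) (a : ℝ) : Measurable (osW k g a) :=
  (osW_meas2 k g).comp (measurable_const.prodMk measurable_id : Measurable fun x => (a, x))

lemma osG_meas2 (k : ℕ) : ∀ t, Measurable fun p : ℝ × (Fin k → ℝ) => osG k p.1 p.2 t := by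
  induction k with
  | zero => intro g; simp only [osG]; fun_prop
  | succ k ih =>
    intro t
    cases t with
    | zero => simp only [osG]; fun_prop
    | succ t =>
      simp only [osG]
      exact (ih t).comp (g := fun p : ℝ × (Fin k → ℝ) => osG k p.1 p.2 t)
        (f := fun p : ℝ × (Fin (k+1) → ℝ) => (p.2 0, fun t : Fin k => p.2 t.succ)) (by fun_prop)

lemma osG_meas (k : ℕ) (t) (a : ℝ) : Measurable (fun u => osG k a u t) :=
  (osG_meas2 k t).comp (measurable_const.prodMk measurable_id : Measurable fun x => (a, x))

lemma osS_succ (k : ℕ) (a : ℝ) (u : Fin (k+1) → ℝ) :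
    u ∈ osS (k+1) a ↔ u 0 ∈ Set.Ioo a 1 ∧ (fun t : Fin k => u t.succ) ∈ osS k (u 0) := by
  have := osS_cons k a (u 0) (fun t => u t.succ)
  rwa [show (Fin.cons (u 0) (fun t => u t.succ) : Fin (k+1) → ℝ) = u from Fin.cons_self_tail u] at this

lemma osG_pos (k : ℕ) : ∀ a < 1, ∀ u ∈ osS k a, ∀ t, 0 < osG k a u t := by
  induction k with
  | zero => intro a ha u _ t; simpa [osG] using ha
  | succ k ih =>
    intro a ha u hu t
    rw [osS_succ] at hu
    cases t with
    | zero => simpa [osG] using hu.1.1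
    | succ t => exact ih _ hu.1.2 _ hu.2 t

lemma osW_eq (k : ℕ) : ∀ g a u, osW k g a u =
    ∏ t ∈ Finset.range (k+1), osG k a u t ^ (g t) / (g t).factorial := by
  induction k with
  | zero => intro g a u; simp [osW, osG]
  | succ k ih =>
    intro g a u
    rw [Finset.prod_range_succ', osW, ih, mul_comm]
    simp [osG]

lemma osW_pos (k : ℕ) (g a) (ha : a < 1) (u) (hu : u ∈ osS k a) : 0 < osW k g a u := by
  rw [osW_eq]
  refine Finset.prod_pos fun t _ => ?_
  have := osG_pos k a ha u hu t
  positivity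

lemma log_osW (k : ℕ) (g a) (ha : a < 1) (u) (hu : u ∈ osS k a) : Real.log (osW k g a u) =
    ∑ t ∈ Finset.range (k+1), (g t * Real.log (osG k a u t) - Real.log (g t).factorial) := by
  rw [osW_eq, Real.log_prod]
  · refine Finset.sum_congr rfl fun t _ => ?_
    have := osG_pos k a ha u hu t
    rw [Real.log_div (by positivity) (by positivity), Real.log_pow]
  · intro t _
    have := osG_pos k a ha u hu t
    positivity

lemma int_conv (a b : ℝ) (p : ℕ) : ∀ q : ℕ,
    ∫ y in a..b, (y - a) ^ p / p.factorial * ((b - y) ^ q / q.factorial) =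
      (b - a) ^ (p + q + 1) / (p + q + 1).factorial := by
  induction p with
  | zero =>
    intro q
    have h : ∀ y ∈ Set.uIcc a b, HasDerivAt (fun y : ℝ => -((b - y) ^ (q+1) / (q+1).factorial))
        ((y - a) ^ 0 / (0).factorial * ((b - y) ^ q / q.factorial)) y := by
      intro y _
      have h1 := ((((hasDerivAt_id y).const_sub b).pow (q+1)).div_const ((q+1).factorial : ℝ)).neg
      refine HasDerivAt.congr_deriv h1 ?_
      simp [Nat.factorial_succ]
      have : (q.factorial : ℝ) ≠ 0 := by positivity
      have : (q + 1 : ℝ) ≠ 0 := by positivity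
      field_simp
    rw [intervalIntegral.integral_eq_sub_of_hasDerivAt h]
    · simp
    · exact (by fun_prop : Continuous _).intervalIntegrable _ _
  | succ p ih =>
    intro q
    have h : ∀ y ∈ Set.uIcc a b, HasDerivAt (fun y : ℝ => (y - a) ^ (p+1) / (p+1).factorial *
          ((b - y) ^ (q+1) / (q+1).factorial))
        ((y - a) ^ p / (p).factorial * ((b - y) ^ (q+1) / (q+1).factorial) -
          (y - a) ^ (p+1) / (p+1).factorial * ((b - y) ^ q / (q).factorial)) y := by
      intro y _
      have h1 := ((((hasDerivAt_id y).const_sub b).pow (q+1)).div_const ((q+1).factorial : ℝ))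
      have h2 := ((((hasDerivAt_id y).sub_const a).pow (p+1)).div_const ((p+1).factorial : ℝ))
      refine HasDerivAt.congr_deriv (h2.mul h1) ?_
      simp [Nat.factorial_succ]
      have : (q.factorial : ℝ) ≠ 0 := by positivity
      have : (q + 1 : ℝ) ≠ 0 := by positivity
      have : (p.factorial : ℝ) ≠ 0 := by positivity
      have : (p + 1 : ℝ) ≠ 0 := by positivity
      field_simp
      ring
    have := intervalIntegral.integral_eq_sub_of_hasDerivAt h
      ((by fun_prop : Continuous _).intervalIntegrable _ _)
    rw [intervalIntegral.integral_sub ((by fun_prop : Continuous _).intervalIntegrable _ _)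
      ((by fun_prop : Continuous _).intervalIntegrable _ _), ih] at this
    simp only [sub_self, ne_eq, Nat.add_eq_zero_iff, one_ne_zero, and_false, not_false_eq_true, zero_pow, zero_div, mul_zero, zero_mul] at this
    rw [show p + 1 + q + 1 = p + (q+1) + 1 by ring]
    linarith

lemma lint_conv (a b : ℝ) (hab : a ≤ b) (p q : ℕ) :
    ∫⁻ y in Set.Ioo a b, ENNReal.ofReal ((y - a) ^ p / p.factorial) *
      ENNReal.ofReal ((b - y) ^ q / q.factorial) =
      ENNReal.ofReal ((b - a) ^ (p + q + 1) / (p + q + 1).factorial) := by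
  rw [← int_conv, intervalIntegral.integral_of_le hab, integral_Ioc_eq_integral_Ioo,
    ofReal_integral_eq_lintegral_ofReal]
  · refine setLIntegral_congr_fun measurableSet_Ioo fun y hy => ?_
    have := sub_pos.2 hy.1
    rw [ENNReal.ofReal_mul (by positivity)]
  · exact ((by fun_prop : Continuous _).integrableOn_Icc (a := a) (b := b)).mono_set Set.Ioo_subset_Icc_self
  · refine (ae_restrict_mem measurableSet_Ioo).mono fun y hy => ?_
    have := sub_pos.2 hy.1
    have := sub_pos.2 hy.2
    simp only [Pi.zero_apply]
    positivity
lemma osS_zero (a : ℝ) : osS 0 a = Set.univ := by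
  ext x
  simp only [osS, Set.mem_ofPred_eq, Set.mem_univ, iff_true]
  exact ⟨fun i => i.elim0, fun i => i.elim0⟩

lemma osW_congr0 (k : ℕ) (g h : ℕ → ℕ) (a : ℝ) (u) (hgh : ∀ t, g t = h t) :
    osW k g a u = osW k h a u := by
  rw [show g = h from funext hgh]

lemma W_int (k : ℕ) (g : ℕ → ℕ) (c : ℕ) (hc : g 0 = c + 1) (a : ℝ) (ha : a < 1) (u : Fin k → ℝ) :
    ∫⁻ y in Set.Ioo a 1, (osS k y).indicator
        (fun u => ENNReal.ofReal (osW k (fun t => if t = 0 then c else g t) y u)) u =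
      (osS k a).indicator (fun u => ENNReal.ofReal (osW k g a u)) u := by
  cases k with
  | zero =>
    simp only [osS_zero, Set.indicator_univ, osW, if_true, hc]
    have := lint_conv a 1 ha.le 0 c
    simpa using this
  | succ k =>
    by_cases hu : u ∈ osS (k+1) a
    · rw [Set.indicator_of_mem hu]
      rw [osS_succ] at hu
      obtain ⟨h1, h2⟩ := hu
      have key : ∀ y ∈ Set.Ioo a 1, (osS (k+1) y).indicator
          (fun u => ENNReal.ofReal (osW (k+1) (fun t => if t = 0 then c else g t) y u)) u =
          (Set.Ioo a (u 0)).indicator (fun y => ENNReal.ofReal ((u 0 - y) ^ c / c.factorial) *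
            ENNReal.ofReal (osW k (fun t => g (t+1)) (u 0) (fun t => u t.succ))) y := by
        intro y hy
        by_cases hy2 : y < u 0
        · rw [Set.indicator_of_mem (by rw [osS_succ]; exact ⟨⟨hy2, h1.2⟩, h2⟩),
            Set.indicator_of_mem (by exact ⟨hy.1, hy2⟩), ← ENNReal.ofReal_mul]
          · simp [osW]
          · have := sub_pos.2 hy2
            positivity
        · rw [Set.indicator_of_notMem (by rw [osS_succ]; exact fun h => hy2 h.1.1),
            Set.indicator_of_notMem (by exact fun h => hy2 h.2)]
      rw [setLIntegral_congr_fun measurableSet_Ioo key, setLIntegral_indicator measurableSet_Ioo,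
        lintegral_mul_const _ (by fun_prop)]
      have hs : Set.Ioo a (u 0) ∩ Set.Ioo a 1 = Set.Ioo a (u 0) := by
        apply Set.inter_eq_left.2
        exact Set.Ioo_subset_Ioo_right h1.2.le
      rw [hs]
      have h3 := lint_conv a (u 0) h1.1.le 0 c
      simp only [pow_zero, Nat.factorial_zero, Nat.cast_one, div_one, ENNReal.ofReal_one, one_mul, zero_add] at h3
      have := sub_pos.2 h1.1
      rw [h3, ← ENNReal.ofReal_mul (by positivity), osW, hc]
    · rw [Set.indicator_of_notMem hu]
      rw [setLIntegral_congr_fun (g := fun _ => 0) measurableSet_Ioo]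
      · simp
      · intro y hy
        refine Set.indicator_of_notMem (fun h => hu ?_) _
        exact ⟨h.1, fun i => ⟨hy.1.trans (h.2 i).1, (h.2 i).2⟩⟩

lemma claimA : ∀ (n k : ℕ) (g : ℕ → ℕ) (idx : Fin k → Fin n),
    (∑ t ∈ Finset.range (k+1), g t + k = n) →
    (∀ t, (idx t : ℕ) = ∑ s ∈ Finset.range (t+1), g s + t) → ∀ a < (1 : ℝ),
    ∀ f : (Fin k → ℝ) → ENNReal, Measurable f →
    ∫⁻ x in osS n a, f (fun t => x (idx t)) =
      ∫⁻ u in osS k a, f u * ENNReal.ofReal (osW k g a u) := by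
  intro n
  induction n with
  | zero =>
    intro k g idx hs hi a ha f hf
    have hk : k = 0 := by omega
    subst hk
    simp only [Finset.range_one, Finset.sum_singleton, zero_add, add_zero] at hs
    refine lintegral_congr fun u => ?_
    simp only [osW, hs]
    simp
    congr 1
    exact Subsingleton.elim _ _
  | succ n ih =>
    intro k g idx hs hi a ha f hf
    rw [lint_osS_cons n a (fun x => f (fun t => x (idx t))) (hf.comp (by fun_prop))]
    rcases hg0 : g 0 with _ | c
    · cases k with
      | zero => simp [hg0] at hs
      | succ k =>
        have h0 : idx 0 = 0 := by
          apply Fin.ext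
          rw [hi]; simp [hg0]
        have hpos : ∀ t : Fin k, idx t.succ ≠ 0 := by
          intro t h
          have := hi t.succ
          rw [h] at this
          simp at this
        have hsum : ∀ m, ∑ s ∈ Finset.range (m+1), g s = ∑ s ∈ Finset.range m, g (s+1) := by
          intro m
          rw [Finset.sum_range_succ', hg0, add_zero]
        have hmm : Measurable fun u => f u * ENNReal.ofReal (osW (k+1) g a u) :=
          hf.mul (osW_meas _ _ _).ennreal_ofReal
        rw [lint_osS_cons k a _ hmm]
        refine setLIntegral_congr_fun measurableSet_Ioo fun y hy => ?_
        have := ih k (fun t => g (t+1)) (fun t => (idx t.succ).pred (hpos t)) ?_ ?_ y hy.2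
          (fun u => f (Fin.cons y u)) (hf.comp ((meas_cons k).comp
            (measurable_const.prodMk measurable_id : Measurable fun x => (y, x))))
        · simp only [osW]
          convert this using 1
          · refine lintegral_congr fun x => ?_
            congr 1
            funext t
            induction t using Fin.cases with
            | zero => simp [h0]
            | succ t =>
              rw [Fin.cons_succ]
              conv_lhs => rw [← Fin.succ_pred _ (hpos t)]
              rw [Fin.cons_succ]
          · refine lintegral_congr fun x => ?_
            simp [hg0]
        · rw [hsum] at hs; omega
        · intro t
          have := hi t.succ
          rw [hsum] at this
          simp only [Fin.val_pred, this, Fin.val_succ]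
          omega
    · have hpos : ∀ t : Fin k, idx t ≠ 0 := by
        intro t h
        have := hi t
        rw [h, Finset.sum_range_succ', hg0, Fin.val_zero] at this
        omega
      set g' : ℕ → ℕ := fun t => if t = 0 then c else g t with hg'
      have hsum : ∀ m, ∑ s ∈ Finset.range (m+1), g s = ∑ s ∈ Finset.range (m+1), g' s + 1 := by
        intro m
        rw [Finset.sum_range_succ', Finset.sum_range_succ' g', hg0]
        simp [hg', add_assoc]
      have step : ∀ y ∈ Set.Ioo a 1, ∫⁻ x in osS n y,
          f (fun t => (Fin.cons y x : Fin (n+1) → ℝ) (idx t)) =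
          ∫⁻ u, f u * (osS k y).indicator (fun u => ENNReal.ofReal (osW k g' y u)) u := by
        intro y hy
        have := ih k g' (fun t => (idx t).pred (hpos t)) ?_ ?_ y hy.2 f hf
        · convert this using 1
          · refine lintegral_congr fun x => ?_
            congr 1
            funext t
            conv_lhs => rw [← Fin.succ_pred _ (hpos t)]
            rw [Fin.cons_succ]
          · rw [← lintegral_indicator (osS_meas _ _)]
            refine lintegral_congr fun x => ?_
            by_cases hx : x ∈ osS k y
            · simp [hx]
            · simp [hx]
        · rw [hsum] at hs; omega
        · intro t
          have := hi t
          rw [hsum] at this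
          simp only [Fin.val_pred, this]
          omega
      rw [setLIntegral_congr_fun measurableSet_Ioo step]
      rw [lintegral_lintegral_swap]
      · rw [← lintegral_indicator (osS_meas _ _)]
        refine lintegral_congr fun u => ?_
        have hm : Measurable fun y : ℝ => (osS k y).indicator (fun u => ENNReal.ofReal (osW k g' y u)) u := by
          have h1 : Measurable ({p : ℝ × (Fin k → ℝ) | p.2 ∈ osS k p.1}.indicator
            (fun p => ENNReal.ofReal (osW k g' p.1 p.2))) :=
            (osW_meas2 k g').ennreal_ofReal.indicator (osS_meas2 k)
          exact h1.comp (measurable_id.prodMk measurable_const : Measurable fun y => (y, u))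
        rw [lintegral_const_mul _ hm, W_int k g c hg0 a ha u]
        by_cases hx : u ∈ osS k a
        · simp [hx]
        · simp [hx]
      · have h1 : Measurable ({p : ℝ × (Fin k → ℝ) | p.2 ∈ osS k p.1}.indicator
            (fun p => ENNReal.ofReal (osW k g' p.1 p.2))) :=
            (osW_meas2 k g').ennreal_ofReal.indicator (osS_meas2 k)
        exact ((hf.comp measurable_snd).mul h1).aemeasurable

lemma claimM (k : ℕ) : ∀ (g : ℕ → ℕ) (N : ℕ), ∑ t ∈ Finset.range (k+1), g t + k = N → ∀ a < (1:ℝ),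
    ∫⁻ u in osS k a, ENNReal.ofReal (osW k g a u) = ENNReal.ofReal ((1 - a) ^ N / N.factorial) := by
  induction k with
  | zero =>
    intro g N h a ha
    simp only [zero_add, Finset.range_one, Finset.sum_singleton, add_zero] at h
    subst h
    simp [osW, osS_zero, volume_pi]
  | succ k ih =>
    intro g N h a ha
    rw [lint_osS_cons k a _ (osW_meas _ _ _).ennreal_ofReal]
    rw [Finset.sum_range_succ'] at h
    have : ∀ y ∈ Set.Ioo a 1, ∫⁻ x in osS k y, ENNReal.ofReal (osW (k+1) g a (Fin.cons y x)) =
        ENNReal.ofReal ((y - a) ^ (g 0) / (g 0).factorial) *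
        ENNReal.ofReal ((1 - y) ^ (∑ t ∈ Finset.range (k+1), g (t+1) + k) /
          (∑ t ∈ Finset.range (k+1), g (t+1) + k).factorial) := by
      intro y hy
      rw [← ih _ _ rfl y hy.2, ← lintegral_const_mul _ (osW_meas _ _ _).ennreal_ofReal]
      refine lintegral_congr fun x => ?_
      have := sub_pos.2 hy.1
      rw [← ENNReal.ofReal_mul (by positivity), osW]
      simp
    rw [setLIntegral_congr_fun measurableSet_Ioo this, lint_conv a 1 ha.le]
    congr 4 <;> omega

lemma lint_shift (a b : ℝ) (F : ℝ → ENNReal) :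
    ∫⁻ y in Set.Ioo a b, F (y - a) = ∫⁻ w in Set.Ioo 0 (b - a), F w := by
  have h := measurePreserving_sub_right (volume : Measure ℝ) a
  rw [← h.setLIntegral_comp_preimage_emb (MeasurableEquiv.subRight a).measurableEmbedding F
    (Set.Ioo 0 (b - a))]
  simp

lemma lint_refl (a b : ℝ) (F : ℝ → ENNReal) :
    ∫⁻ y in Set.Ioo a b, F (b - y) = ∫⁻ w in Set.Ioo 0 (b - a), F w := by
  have h := Measure.measurePreserving_sub_left (volume : Measure ℝ) b
  rw [← h.setLIntegral_comp_preimage_emb (MeasurableEquiv.subLeft b).measurableEmbedding F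
    (Set.Ioo 0 (b - a))]
  simp

lemma claimB (k : ℕ) : ∀ (g : ℕ → ℕ) (t c : ℕ), t ≤ k + 1 →
    ∑ t ∈ Finset.range (k+2), g t + (k + 1) = g t + c + 1 → ∀ a < (1:ℝ),
    ∀ φ : ℝ → ENNReal, Measurable φ →
    ∫⁻ u in osS (k+1) a, φ (osG (k+1) a u t) * ENNReal.ofReal (osW (k+1) g a u) =
      ∫⁻ w in Set.Ioo 0 (1-a), φ w * (ENNReal.ofReal (w ^ (g t) / (g t).factorial) *
        ENNReal.ofReal ((1 - a - w) ^ c / c.factorial)) := by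
  induction k with
  | zero =>
    intro g t c ht hs a ha φ hφ
    have hmm : Measurable fun u => φ (osG (0+1) a u t) * ENNReal.ofReal (osW (0+1) g a u) :=
      (hφ.comp (osG_meas _ _ _)).mul (osW_meas _ _ _).ennreal_ofReal
    rw [lint_osS_cons 0 a _ hmm]
    have e : ∀ y ∈ Set.Ioo a 1, ∫⁻ x in osS 0 y, φ (osG (0+1) a (Fin.cons y x) t) *
          ENNReal.ofReal (osW (0+1) g a (Fin.cons y x)) =
        φ (osG (0+1) a (fun _ => y) t) * (ENNReal.ofReal ((y - a) ^ (g 0) / (g 0).factorial) *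
        ENNReal.ofReal ((1 - y) ^ (g 1) / (g 1).factorial)) := by
      intro y hy
      have hh : ∀ x : Fin 0 → ℝ, (Fin.cons y x : Fin (0+1) → ℝ) = fun _ => y := by
        intro x; funext i; rw [Fin.fin_one_eq_zero i]; rfl
      have := sub_pos.2 hy.1
      simp only [hh, osS_zero, osW]
      rw [← ENNReal.ofReal_mul (by positivity)]
      simp [volume_pi]
    rw [setLIntegral_congr_fun measurableSet_Ioo e]
    simp only [Finset.sum_range_succ, Finset.range_zero, Finset.sum_empty] at hs
    rcases t with _ | t
    · rw [← lint_shift a 1 (fun w => φ w * (ENNReal.ofReal (w ^ (g 0) / (g 0).factorial) *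
        ENNReal.ofReal ((1 - a - w) ^ c / c.factorial)))]
      have : c = g 1 := by omega
      subst this
      simp only [osG]
      refine lintegral_congr fun y => ?_
      congr 4
      ring
    · have : t = 0 := by omega
      subst this
      rw [← lint_refl a 1 (fun w => φ w * (ENNReal.ofReal (w ^ (g (0+1)) / (g (0+1)).factorial) *
        ENNReal.ofReal ((1 - a - w) ^ c / c.factorial)))]
      simp only [zero_add] at hs
      have : c = g 0 := by omega
      subst this
      simp only [osG]
      refine lintegral_congr fun y => ?_
      rw [mul_comm (ENNReal.ofReal ((y - a) ^ (g 0) / (g 0).factorial))]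
      congr 4
      ring
  | succ k ih =>
    intro g t c ht hs a ha φ hφ
    have hmm : Measurable fun u => φ (osG (k+1+1) a u t) * ENNReal.ofReal (osW (k+1+1) g a u) :=
      (hφ.comp (osG_meas _ _ _)).mul (osW_meas _ _ _).ennreal_ofReal
    rw [lint_osS_cons (k+1) a _ hmm]
    rw [Finset.sum_range_succ'] at hs
    rcases t with _ | t
    · have e : ∀ y ∈ Set.Ioo a 1, ∫⁻ x in osS (k+1) y, φ (osG (k+1+1) a (Fin.cons y x) 0) *
          ENNReal.ofReal (osW (k+1+1) g a (Fin.cons y x)) =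
          φ (y - a) * (ENNReal.ofReal ((y - a) ^ (g 0) / (g 0).factorial) *
            ENNReal.ofReal ((1 - a - (y - a)) ^ c / c.factorial)) := by
        intro y hy
        have := sub_pos.2 hy.1
        rw [show 1 - a - (y - a) = 1 - y by ring,
          ← claimM (k+1) (fun t => g (t+1)) c (by rw [show k + 1 + 1 = k + 2 from rfl]; omega) y hy.2, ← mul_assoc,
          ← lintegral_const_mul _ (osW_meas _ _ _).ennreal_ofReal]
        refine lintegral_congr fun x => ?_
        rw [mul_assoc, ← ENNReal.ofReal_mul (by positivity)]
        simp [osW, osG]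
      rw [setLIntegral_congr_fun measurableSet_Ioo e]
      exact lint_shift a 1 (fun w => φ w * (ENNReal.ofReal (w ^ (g 0) / (g 0).factorial) *
        ENNReal.ofReal ((1 - a - w) ^ c / c.factorial)))
    · have hle : g (t+1) ≤ ∑ s ∈ Finset.range (k+2), g (s+1) :=
        Finset.single_le_sum (f := fun s => g (s+1)) (fun _ _ => Nat.zero_le _)
          (Finset.mem_range.2 (by omega))
      obtain ⟨d, hd⟩ : ∃ d, g 0 + d + 1 = c := ⟨c - 1 - g 0, by omega⟩
      set F : ℝ → ENNReal := fun w => φ w * ENNReal.ofReal (w ^ (g (t+1)) / (g (t+1)).factorial)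
        with hF
      have hFm : Measurable F := by fun_prop
      have e : ∀ y ∈ Set.Ioo a 1, ∫⁻ x in osS (k+1) y, φ (osG (k+1+1) a (Fin.cons y x) (t+1)) *
          ENNReal.ofReal (osW (k+1+1) g a (Fin.cons y x)) =
          ∫⁻ w in Set.Ioo 0 (1 - a), F w * (Set.Ioo a (1 - w)).indicator (fun y =>
            ENNReal.ofReal ((y - a) ^ (g 0) / (g 0).factorial) *
            ENNReal.ofReal ((1 - w - y) ^ d / d.factorial)) y := by
        intro y hy
        have h0 := sub_pos.2 hy.1
        have := ih (fun t => g (t+1)) t d (by omega) (by omega) y hy.2 φ hφ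
        calc _ = ∫⁻ x in osS (k+1) y, ENNReal.ofReal ((y - a) ^ (g 0) / (g 0).factorial) *
              (φ (osG (k+1) y x t) * ENNReal.ofReal (osW (k+1) (fun t => g (t+1)) y x)) := by
              refine lintegral_congr fun x => ?_
              rw [mul_left_comm, ← ENNReal.ofReal_mul (by positivity)]
              simp [osW, osG]
          _ = _ := by
              have hmm2 : Measurable fun u => φ (osG (k+1) y u t) *
                  ENNReal.ofReal (osW (k+1) (fun t => g (t+1)) y u) :=
                (hφ.comp (osG_meas _ _ _)).mul (osW_meas _ _ _).ennreal_ofReal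
              rw [lintegral_const_mul _ hmm2, this, ← lintegral_const_mul _ (by fun_prop)]
              have h5 : Set.Ioo 0 (1 - y) = Set.Ioo 0 (1 - y) ∩ Set.Ioo 0 (1 - a) := by
                apply (Set.inter_eq_left.2 _).symm
                exact Set.Ioo_subset_Ioo_right (by linarith)
              rw [h5, ← setLIntegral_indicator measurableSet_Ioo]
              refine setLIntegral_congr_fun measurableSet_Ioo fun w hw => ?_
              by_cases hwy : w < 1 - y
              · rw [Set.indicator_of_mem (by exact ⟨hw.1, hwy⟩),
                  Set.indicator_of_mem (by exact ⟨hy.1, by linarith⟩), hF]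
                rw [show 1 - y - w = 1 - w - y by ring]
                ring
              · rw [Set.indicator_of_notMem (by exact fun h => hwy h.2),
                  Set.indicator_of_notMem (by exact fun h => hwy (by linarith [h.2])), mul_zero]
      rw [setLIntegral_congr_fun measurableSet_Ioo e]
      have hset : MeasurableSet {p : ℝ × ℝ | p.1 ∈ Set.Ioo a (1 - p.2)} :=
        (measurableSet_lt (f := fun p : ℝ × ℝ => a) (g := fun p => p.1) (by fun_prop)
          (by fun_prop)).inter
          (measurableSet_lt (f := fun p : ℝ × ℝ => p.1) (g := fun p => 1 - p.2) (by fun_prop)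
            (by fun_prop))
      have hm : Measurable ({p : ℝ × ℝ | p.1 ∈ Set.Ioo a (1 - p.2)}.indicator (fun p =>
            ENNReal.ofReal ((p.1 - a) ^ (g 0) / (g 0).factorial) *
            ENNReal.ofReal ((1 - p.2 - p.1) ^ d / d.factorial))) :=
        Measurable.indicator (by fun_prop) hset
      rw [lintegral_lintegral_swap]
      · refine setLIntegral_congr_fun measurableSet_Ioo fun w hw => ?_
        have hmw : Measurable fun y : ℝ => (Set.Ioo a (1 - w)).indicator (fun y =>
            ENNReal.ofReal ((y - a) ^ (g 0) / (g 0).factorial) *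
            ENNReal.ofReal ((1 - w - y) ^ d / d.factorial)) y :=
          hm.comp (measurable_id.prodMk measurable_const : Measurable fun y => (y, w))
        rw [lintegral_const_mul _ hmw, setLIntegral_indicator measurableSet_Ioo,
          Set.inter_eq_left.2 (Set.Ioo_subset_Ioo_right (by linarith [hw.1])),
          lint_conv a (1 - w) (by linarith [hw.2]), hd, hF,
          show 1 - w - a = 1 - a - w by ring]
        ring
      · exact ((hFm.comp measurable_snd).mul hm).aemeasurable
lemma sampleLaw_unif (n : ℕ) : sampleLaw n unif =
    volume.restrict (Set.univ.pi fun _ : Fin n => Set.Ioo (0:ℝ) 1) := by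
  rw [sampleLaw, unif, volume_pi, Measure.restrict_pi_pi]

instance unif_prob : IsProbabilityMeasure unif := ⟨by simp [unif]⟩

instance sampleLaw_prob (n : ℕ) : IsProbabilityMeasure (sampleLaw n unif) := by
  unfold sampleLaw; infer_instance

lemma ae_inj (n : ℕ) : ∀ᵐ x ∂(sampleLaw n unif), Function.Injective x := by
  have h : ∀ᵐ x : Fin n → ℝ, ∀ i j : Fin n, i ≠ j → x i ≠ x j := by
    rw [ae_all_iff]; intro i
    rw [ae_all_iff]; intro j
    by_cases hij : i = j
    · simp [hij]
    · let s : Submodule ℝ (Fin n → ℝ) :=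
        LinearMap.ker (LinearMap.proj (R := ℝ) (φ := fun _ : Fin n => ℝ) i - LinearMap.proj j)
      have hs : s ≠ ⊤ := by
        intro h
        have : (Pi.single i (1:ℝ) : Fin n → ℝ) ∈ s := by rw [h]; trivial
        simp [s, LinearMap.mem_ker, hij, Ne.symm hij] at this
      have h0 := Measure.addHaar_submodule (volume : Measure (Fin n → ℝ)) s hs
      refine (measure_eq_zero_iff_ae_notMem.1 h0).mono fun x hx _ hxx => hx ?_
      simp [s, LinearMap.mem_ker, hxx]
  rw [sampleLaw_unif]
  refine ae_restrict_of_ae (h.mono fun x hx => ?_)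
  intro i j hij
  by_contra hne
  exact hx i j hne hij

lemma sum_perm_sort {M : Type*} [AddCommMonoid M] (n : ℕ) (x : Fin n → ℝ)
    (hx : Function.Injective x) (h : (Fin n → ℝ) → M) :
    ∑ σ : Equiv.Perm (Fin n), (if StrictMono (fun i => x (σ i)) then h (fun i => x (σ i)) else 0) =
      h (sortTuple x) := by
  rw [Finset.sum_eq_single (Tuple.sort x)]
  · rw [if_pos]
    · rfl
    · exact (Tuple.monotone_sort x).strictMono_of_injective (hx.comp (Tuple.sort x).injective)
  · intro σ _ hσ
    rw [if_neg]
    intro hm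
    apply hσ
    have h1 := Tuple.unique_monotone (f := x) (σ := σ) (τ := Tuple.sort x) hm.monotone
      (Tuple.monotone_sort x)
    ext i
    exact congrArg _ (hx (congrFun h1 i))
  · intro h; exact absurd (Finset.mem_univ _) h

lemma meas_strictMono (n : ℕ) : MeasurableSet {x : Fin n → ℝ | StrictMono x} := by
  have : {x : Fin n → ℝ | StrictMono x} =
      (⋂ i : Fin n, ⋂ j : Fin n, {x : (Fin n → ℝ) | i < j → x i < x j}) := by
    ext p
    simp only [StrictMono, Set.mem_ofPred_eq, Set.mem_iInter]
  rw [this]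
  refine (MeasurableSet.iInter fun i => MeasurableSet.iInter fun j => ?_)
  by_cases h : i < j
  · simp only [h, true_imp_iff]
    exact measurableSet_lt (by fun_prop) (by fun_prop)
  · simp [h]

lemma meas_ite_mono {M : Type*} [MeasurableSpace M] [Zero M] (n : ℕ) (h : (Fin n → ℝ) → M)
    (hh : Measurable h) :
    Measurable fun x : Fin n → ℝ => if StrictMono x then h x else 0 :=
  Measurable.ite (meas_strictMono n) hh measurable_const

lemma aemeas_sort (n : ℕ) : AEMeasurable (fun x : Fin n → ℝ => sortTuple x) (sampleLaw n unif) := by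
  refine ⟨fun x => ∑ σ : Equiv.Perm (Fin n),
    (if StrictMono (fun i => x (σ i)) then (fun i => x (σ i)) else 0), ?_, ?_⟩
  · refine Finset.measurable_sum _ fun σ _ => ?_
    exact (meas_ite_mono n (fun x => x) measurable_id).comp
      (by fun_prop : Measurable fun x : Fin n → ℝ => fun i => x (σ i))
  · exact (ae_inj n).mono fun x hx => (sum_perm_sort n x hx (fun y => y)).symm

lemma lint_sort (n : ℕ) (f : (Fin n → ℝ) → ENNReal) (hf : Measurable f) :
    ∫⁻ x, f (sortTuple x) ∂(sampleLaw n unif) = n.factorial * ∫⁻ x in osS n 0, f x := by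
  have h1 : ∫⁻ x, f (sortTuple x) ∂(sampleLaw n unif) = ∫⁻ x, ∑ σ : Equiv.Perm (Fin n),
      (if StrictMono (fun i => x (σ i)) then f (fun i => x (σ i)) else 0) ∂(sampleLaw n unif) :=
    lintegral_congr_ae ((ae_inj n).mono fun x hx => (sum_perm_sort n x hx f).symm)
  have hm := meas_ite_mono n f hf
  have h2 : ∀ σ : Equiv.Perm (Fin n), ∫⁻ x,
      (if StrictMono (fun i => x (σ i)) then f (fun i => x (σ i)) else 0) ∂(sampleLaw n unif) =
      ∫⁻ x in osS n 0, f x := by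
    intro σ
    have hp := (measurePreserving_piCongrLeft (fun _ : Fin n => unif) σ.symm)
    have h3 := hp.lintegral_comp hm
    have h4 : ∀ x : Fin n → ℝ, MeasurableEquiv.piCongrLeft (fun _ : Fin n => ℝ) σ.symm x =
        fun i => x (σ i) := by
      intro x; funext i
      have := MeasurableEquiv.piCongrLeft_apply_apply (β := fun _ : Fin n => ℝ) σ.symm x (σ i)
      simpa using this
    simp_rw [h4] at h3
    unfold sampleLaw
    rw [h3]
    change ∫⁻ x, _ ∂(sampleLaw n unif) = _
    rw [sampleLaw_unif, ← lintegral_indicator (osS_meas _ _),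
      ← lintegral_indicator (MeasurableSet.univ_pi fun _ => measurableSet_Ioo)]
    refine lintegral_congr fun x => ?_
    simp only [Set.indicator_apply, osS, Set.mem_univ_pi, Set.mem_ofPred_eq]
    by_cases ha : StrictMono x <;> by_cases hb : ∀ i, x i ∈ Set.Ioo (0:ℝ) 1 <;> simp only [ha, hb, if_true, if_false, true_and, false_and, and_true, and_false, implies_true]
  have h5 : ∀ σ : Equiv.Perm (Fin n), Measurable fun x : Fin n → ℝ =>
      (if StrictMono (fun i => x (σ i)) then f (fun i => x (σ i)) else 0) := fun σ => hm.comp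
      (by fun_prop : Measurable fun x : Fin n → ℝ => fun i => x (σ i))
  rw [h1, lintegral_finsetSum _ fun σ _ => h5 σ,
    Finset.sum_congr rfl fun σ _ => h2 σ]
  simp [Fintype.card_perm]

lemma ii_log (b c : ℕ) : IntervalIntegrable
    (fun w : ℝ => Real.log w * (w ^ b / b.factorial * ((1 - w) ^ c / c.factorial))) volume 0 1 :=
  intervalIntegral.intervalIntegrable_log'.mul_continuousOn (by fun_prop)

lemma int_log (c : ℕ) : ∀ b : ℕ,
    ∫ w in (0:ℝ)..1, Real.log w * (w ^ b / b.factorial * ((1 - w) ^ c / c.factorial)) =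
      ((harmonic b : ℝ) - harmonic (b + c + 1)) / (b + c + 1).factorial := by
  induction c with
  | zero =>
    intro b
    have hcont : Continuous fun w : ℝ => (w ^ b * (w * Real.log w) / (b+1) - w ^ (b+1) / (b+1)^2) / b.factorial := by
      have := Real.continuous_mul_log
      fun_prop
    rw [intervalIntegral.integral_eq_sub_of_hasDerivAt_of_le zero_le_one hcont.continuousOn ?_ (ii_log b 0)]
    · simp [harmonic_succ, Nat.factorial_succ]
      have : (b.factorial : ℝ) ≠ 0 := by positivity
      have : (b + 1 : ℝ) ≠ 0 := by positivity
      field_simp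
    · intro w hw
      have hw0 : w ≠ 0 := hw.1.ne'
      have h1 := ((((hasDerivAt_pow (b+1) w).mul (Real.hasDerivAt_log hw0)).div_const (b+1:ℝ)).sub
        ((hasDerivAt_pow (b+1) w).div_const ((b+1:ℝ)^2))).div_const (b.factorial : ℝ)
      have h2 : (fun w : ℝ => (w ^ b * (w * Real.log w) / (b+1) - w ^ (b+1) / (b+1)^2) / b.factorial) =
        fun w : ℝ => (w ^ (b+1) * Real.log w / (b+1) - w ^ (b+1) / (b+1)^2) / b.factorial := by
        funext w; ring
      rw [h2]
      refine HasDerivAt.congr_deriv h1 ?_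
      simp only [Nat.cast_add, Nat.cast_one, Nat.add_sub_cancel, pow_zero, Nat.factorial_zero]
      have : (b.factorial : ℝ) ≠ 0 := by positivity
      have : (b + 1 : ℝ) ≠ 0 := by positivity
      field_simp
      ring
  | succ c ih =>
    intro b
    have e : ∀ w : ℝ, Real.log w * (w ^ b / b.factorial * ((1 - w) ^ (c+1) / (c+1).factorial)) =
        (1 / (c+1:ℝ)) * (Real.log w * (w ^ b / b.factorial * ((1 - w) ^ c / c.factorial)) -
          (b+1) * (Real.log w * (w ^ (b+1) / (b+1).factorial * ((1 - w) ^ c / c.factorial)))) := by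
      intro w
      simp only [Nat.factorial_succ, Nat.cast_mul, Nat.cast_add, Nat.cast_one]
      have : (b.factorial : ℝ) ≠ 0 := by positivity
      have : (c.factorial : ℝ) ≠ 0 := by positivity
      have : (b + 1 : ℝ) ≠ 0 := by positivity
      have : (c + 1 : ℝ) ≠ 0 := by positivity
      field_simp
      ring
    simp_rw [e]
    rw [intervalIntegral.integral_const_mul, intervalIntegral.integral_sub (ii_log b c)
      ((ii_log (b+1) c).const_mul _), intervalIntegral.integral_const_mul, ih, ih,
      show b + 1 + c + 1 = (b + c + 1) + 1 by ring, show b + (c + 1) + 1 = (b + c + 1) + 1 by ring,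
      harmonic_succ b, harmonic_succ (b + c + 1), Nat.factorial_succ (b+c+1)]
    push_cast
    have : ((b+c+1).factorial : ℝ) ≠ 0 := by positivity
    have : (b + 1 : ℝ) ≠ 0 := by positivity
    have : (c + 1 : ℝ) ≠ 0 := by positivity
    have : (b + c + 1 + 1 : ℝ) ≠ 0 := by positivity
    field_simp
    ring

/-- beta density -/
def bdens (n b c : ℕ) (w : ℝ) : ENNReal := (Set.Ioo (0:ℝ) 1).indicator
  (fun w => ENNReal.ofReal (n.factorial * (w ^ b / b.factorial * ((1 - w) ^ c / c.factorial)))) w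

lemma bdens_meas (n b c : ℕ) : Measurable (bdens n b c) := by
  unfold bdens
  exact Measurable.indicator (by fun_prop) measurableSet_Ioo

lemma bdens_lt (n b c : ℕ) (w) : bdens n b c w < ⊤ := by
  unfold bdens
  rw [Set.indicator_apply]
  split_ifs
  · exact ENNReal.ofReal_lt_top
  · simp

lemma bdens_gen (n b c : ℕ) (φ : ℝ → ℝ) :
    (Integrable φ (volume.withDensity (bdens n b c)) ↔
      IntervalIntegrable (fun w => φ w * (w ^ b / b.factorial * ((1 - w) ^ c / c.factorial))) volume 0 1) ∧
    ∫ w, φ w ∂(volume.withDensity (bdens n b c)) = n.factorial *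
      ∫ w in (0:ℝ)..1, φ w * (w ^ b / b.factorial * ((1 - w) ^ c / c.factorial)) := by
  have e : ∀ w, (bdens n b c w).toReal * φ w = (Set.Ioo (0:ℝ) 1).indicator (fun w => n.factorial *
      (φ w * (w ^ b / b.factorial * ((1 - w) ^ c / c.factorial)))) w := by
    intro w
    unfold bdens
    by_cases hw : w ∈ Set.Ioo (0:ℝ) 1
    · have := hw.1
      have := sub_pos.2 hw.2
      rw [Set.indicator_of_mem hw, Set.indicator_of_mem hw, ENNReal.toReal_ofReal (by positivity)]
      ring
    · rw [Set.indicator_of_notMem hw, Set.indicator_of_notMem hw]; simp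
  have hlt : ∀ᵐ w, bdens n b c w < ⊤ := Eventually.of_forall (bdens_lt n b c)
  constructor
  · rw [integrable_withDensity_iff_integrable_smul' (bdens_meas n b c) hlt]
    simp_rw [smul_eq_mul, e]
    rw [integrable_indicator_iff measurableSet_Ioo, intervalIntegrable_iff_integrableOn_Ioo_of_le zero_le_one]
    have h0 : (n.factorial : ℝ) ≠ 0 := by positivity
    exact integrable_const_mul_iff h0.isUnit _
  · rw [integral_withDensity_eq_integral_toReal_smul (bdens_meas n b c) hlt]
    simp_rw [smul_eq_mul, e]
    rw [integral_indicator measurableSet_Ioo, integral_const_mul,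
      intervalIntegral.integral_of_le zero_le_one, integral_Ioc_eq_integral_Ioo]

lemma bdens_log (n b c : ℕ) (h : b + c + 1 = n) :
    Integrable Real.log (volume.withDensity (bdens n b c)) ∧
    ∫ w, Real.log w ∂(volume.withDensity (bdens n b c)) = (harmonic b : ℝ) - harmonic n := by
  obtain ⟨h1, h2⟩ := bdens_gen n b c Real.log
  refine ⟨h1.2 (ii_log b c), ?_⟩
  rw [h2, int_log, h]
  have h0 : (n.factorial : ℝ) ≠ 0 := by positivity
  field_simp

lemma bdens_log' (n b c : ℕ) (h : b + c + 1 = n) :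
    Integrable (fun w => Real.log (1 - w)) (volume.withDensity (bdens n b c)) ∧
    ∫ w, Real.log (1 - w) ∂(volume.withDensity (bdens n b c)) = (harmonic c : ℝ) - harmonic n := by
  obtain ⟨h1, h2⟩ := bdens_gen n b c (fun w => Real.log (1 - w))
  have e : (fun w : ℝ => Real.log (1 - w) * (w ^ b / b.factorial * ((1 - w) ^ c / c.factorial))) =
    fun w : ℝ => (fun w : ℝ => Real.log w * (w ^ c / c.factorial * ((1 - w) ^ b / b.factorial))) (1 - w) := by
    funext w
    simp only [sub_sub_cancel]
    ring
  rw [e] at h1 h2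
  refine ⟨h1.2 ?_, ?_⟩
  · have := ((ii_log c b).comp_sub_left 1).symm
    simpa using this
  · rw [h2, intervalIntegral.integral_comp_sub_left (fun w : ℝ => Real.log w * (w ^ c / c.factorial * ((1 - w) ^ b / b.factorial))) 1]
    simp only [sub_self, sub_zero]
    rw [int_log, show c + b + 1 = n by omega]
    have h0 : (n.factorial : ℝ) ≠ 0 := by positivity
    field_simp

lemma lint_prod (k : ℕ) : ∀ (f : Fin k → ℝ → ENNReal), (∀ t, Measurable (f t)) →
    ∫⁻ u : Fin k → ℝ, ∏ t, f t (u t) = ∏ t, ∫⁻ x, f t x := by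
  induction k with
  | zero => intro f _; simp [volume_pi]
  | succ k ih =>
    intro f hf
    have hm0 : Measurable fun u : Fin (k+1) → ℝ => ∏ t, f t (u t) :=
      Finset.measurable_fun_prod _ fun t _ => (hf t).comp (measurable_pi_apply t)
    rw [lint_cons _ _ hm0,
      Fin.prod_univ_succ, ← ih _ fun t => hf t.succ]
    simp_rw [Fin.prod_univ_succ, Fin.cons_zero, Fin.cons_succ]
    have hm : Measurable fun u : Fin k → ℝ => ∏ t, f t.succ (u t) :=
      Finset.measurable_fun_prod _ fun t _ => (hf t.succ).comp (measurable_pi_apply t)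
    simp_rw [lintegral_const_mul _ hm]
    rw [lintegral_mul_const _ (hf 0)]

lemma pi_dens (k : ℕ) (f : Fin k → ℝ → ENNReal) (hf : ∀ t, Measurable (f t))
    [∀ t, SigmaFinite (volume.withDensity (f t))] :
    Measure.pi (fun t => volume.withDensity (f t)) =
      (volume : Measure (Fin k → ℝ)).withDensity fun u => ∏ t, f t (u t) := by
  refine Measure.pi_eq fun s hs => ?_
  rw [withDensity_apply _ (MeasurableSet.univ_pi hs),
    ← lintegral_indicator (MeasurableSet.univ_pi hs)]
  have : ∀ u : Fin k → ℝ, (Set.univ.pi s).indicator (fun u => ∏ t, f t (u t)) u =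
      ∏ t, (s t).indicator (f t) (u t) := by
    intro u
    by_cases hu : u ∈ Set.univ.pi s
    · rw [Set.indicator_of_mem hu]
      exact Finset.prod_congr rfl fun t _ => (Set.indicator_of_mem (hu t trivial) _).symm
    · rw [Set.indicator_of_notMem hu]
      simp only [Set.mem_univ_pi, not_forall] at hu
      obtain ⟨t, ht⟩ := hu
      exact (Finset.prod_eq_zero (Finset.mem_univ t) (Set.indicator_of_notMem ht _)).symm
  simp_rw [this]
  rw [lint_prod _ _ fun t => (hf t).indicator (hs t)]
  refine Finset.prod_congr rfl fun t _ => ?_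
  rw [lintegral_indicator (hs t), withDensity_apply _ (hs t)]
lemma aemeas_idx (n k : ℕ) (idx : Fin k → Fin n) :
    AEMeasurable (fun (x : Fin n → ℝ) (t : Fin k) => sortTuple x (idx t)) (sampleLaw n unif) :=
  (by fun_prop : Measurable fun (y : Fin n → ℝ) (t : Fin k) => y (idx t)).comp_aemeasurable
    (aemeas_sort n)

/-- joint law -/
def jLaw (n k : ℕ) (idx : Fin k → Fin n) : Measure (Fin k → ℝ) :=
  (sampleLaw n unif).map fun x t => sortTuple x (idx t)

instance jLaw_prob (n k : ℕ) (idx : Fin k → Fin n) : IsProbabilityMeasure (jLaw n k idx) :=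
  Measure.isProbabilityMeasure_map (aemeas_idx n k idx)

lemma lint_jLaw (n k : ℕ) (g : ℕ → ℕ) (idx : Fin k → Fin n)
    (hs : ∑ t ∈ Finset.range (k+1), g t + k = n)
    (hi : ∀ t, (idx t : ℕ) = ∑ s ∈ Finset.range (t+1), g s + t)
    (f : (Fin k → ℝ) → ENNReal) (hf : Measurable f) :
    ∫⁻ u, f u ∂(jLaw n k idx) =
      n.factorial * ∫⁻ u in osS k 0, f u * ENNReal.ofReal (osW k g 0 u) := by
  rw [jLaw, lintegral_map' hf.aemeasurable (aemeas_idx n k idx),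
    lint_sort n (fun y => f (fun t => y (idx t))) (hf.comp (by fun_prop)),
    claimA n k g idx hs hi 0 one_pos f hf]

/-- joint density -/
def jdens (n k : ℕ) (g : ℕ → ℕ) (u : Fin k → ℝ) : ENNReal :=
  (osS k 0).indicator (fun u => ENNReal.ofReal (n.factorial * osW k g 0 u)) u

lemma jdens_meas (n k : ℕ) (g : ℕ → ℕ) : Measurable (jdens n k g) :=
  Measurable.indicator ((osW_meas k g 0).const_mul _).ennreal_ofReal (osS_meas k 0)

lemma jLaw_dens (n k : ℕ) (g : ℕ → ℕ) (idx : Fin k → Fin n)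
    (hs : ∑ t ∈ Finset.range (k+1), g t + k = n)
    (hi : ∀ t, (idx t : ℕ) = ∑ s ∈ Finset.range (t+1), g s + t) :
    jLaw n k idx = volume.withDensity (jdens n k g) := by
  ext s hsm
  rw [← lintegral_indicator_one hsm, lint_jLaw n k g idx hs hi _ (measurable_one.indicator hsm),
    withDensity_apply _ hsm, ← lintegral_indicator hsm, ← lintegral_indicator (osS_meas _ _),
    ← lintegral_const_mul]
  · refine lintegral_congr fun u => ?_
    unfold jdens
    by_cases h1 : u ∈ s <;> by_cases h2 : u ∈ osS k 0 <;>
      simp [h1, h2, ENNReal.ofReal_mul]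
  · exact ((measurable_one.indicator hsm).mul (osW_meas k g 0).ennreal_ofReal).indicator (osS_meas k 0)

lemma jLaw_gap (n k : ℕ) (g : ℕ → ℕ) (idx : Fin (k+1) → Fin n)
    (hs : ∑ t ∈ Finset.range (k+2), g t + (k + 1) = n)
    (hi : ∀ t, (idx t : ℕ) = ∑ s ∈ Finset.range (t+1), g s + t)
    (t c : ℕ) (ht : t ≤ k + 1) (hc : g t + c + 1 = n) :
    (jLaw n (k+1) idx).map (fun u => osG (k+1) 0 u t) = volume.withDensity (bdens n (g t) c) := by
  ext s hsm
  have hφ : Measurable (s.indicator (1 : ℝ → ENNReal)) := measurable_one.indicator hsm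
  have hm : Measurable fun u : Fin (k+1) → ℝ => s.indicator (1:ℝ→ENNReal) (osG (k+1) 0 u t) :=
    hφ.comp (osG_meas _ _ _)
  rw [← lintegral_indicator_one hsm, lintegral_map hφ (osG_meas _ _ _),
    lint_jLaw n (k+1) g idx hs hi _ hm,
    claimB k g t c ht (by omega) 0 one_pos _ hφ,
    withDensity_apply _ hsm, ← lintegral_indicator hsm, ← lintegral_indicator measurableSet_Ioo,
    ← lintegral_const_mul]
  · refine lintegral_congr fun w => ?_
    unfold bdens
    simp only [sub_zero]
    by_cases h2 : w ∈ Set.Ioo (0:ℝ) 1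
    · have := h2.1
      by_cases h1 : w ∈ s
      · simp only [Set.indicator_of_mem h1, Set.indicator_of_mem h2]
        rw [ENNReal.ofReal_mul (by positivity), ENNReal.ofReal_mul (by positivity)]
        simp
      · simp [h1]
    · by_cases h1 : w ∈ s
      · simp only [Set.indicator_of_mem h1, Set.indicator_of_notMem h2]
        simp
      · simp [h1]
  · exact (hφ.mul (by fun_prop)).indicator measurableSet_Ioo

lemma osLaw_eq (n k : ℕ) (idx : Fin k → Fin n) (t : Fin k) :
    (jLaw n k idx).map (fun u => u t) = osLaw n unif (idx t) := by
  rw [jLaw, osLaw, AEMeasurable.map_map_of_aemeasurable (measurable_pi_apply t).aemeasurable (aemeas_idx n k idx)]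
  rfl

lemma osLaw_dens (n : ℕ) (i : Fin n) :
    osLaw n unif i = volume.withDensity (bdens n i (n - i - 1)) := by
  have hi := i.isLt
  have h := jLaw_gap n 0 (fun t => if t = 0 then (i:ℕ) else n - i - 1) (fun _ => i)
    (by simp [Finset.sum_range_succ]; omega)
    (by intro t; rw [Fin.fin_one_eq_zero t]; simp) 0 (n - i - 1) (by omega) (by simp; omega)
  simp only [osG, sub_zero, if_true] at h
  rw [← h]
  exact (osLaw_eq n 1 (fun _ => i) 0).symm

instance osLaw_prob (n : ℕ) (i : Fin n) : IsProbabilityMeasure (osLaw n unif i) :=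
  Measure.isProbabilityMeasure_map
    ((measurable_pi_apply i).comp_aemeasurable (aemeas_sort n))

lemma main_gen (n k : ℕ) (g : ℕ → ℕ) (idx : Fin (k+1) → Fin n)
    (hs : ∑ t ∈ Finset.range (k+2), g t + (k + 1) = n)
    (hi : ∀ t, (idx t : ℕ) = ∑ s ∈ Finset.range (t+1), g s + t) :
    klDiv (jLaw n (k+1) idx) (Measure.pi fun t => osLaw n unif (idx t)) =
    ((Real.log n.factorial + ∑ t ∈ Finset.range (k+2), (g t * ((harmonic (g t) : ℝ) - harmonic n)
        - Real.log (g t).factorial) -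
      ∑ t : Fin (k+1), (Real.log n.factorial +
        ((idx t : ℕ) * ((harmonic (idx t) : ℝ) - harmonic n) - Real.log (idx t : ℕ).factorial) +
        ((n - idx t - 1 : ℕ) * ((harmonic (n - idx t - 1) : ℝ) - harmonic n)
          - Real.log (n - idx t - 1).factorial)) : ℝ) : EReal) := by
  set P := jLaw n (k+1) idx with hPdef
  set p := jdens n (k+1) g with hp
  set f : Fin (k+1) → ℝ → ENNReal := fun t => bdens n (idx t) (n - idx t - 1) with hf
  set q : (Fin (k+1) → ℝ) → ENNReal := fun u => ∏ t, f t (u t) with hq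
  have hP : P = volume.withDensity p := jLaw_dens n (k+1) g idx hs hi
  have hfm : ∀ t, Measurable (f t) := fun t => bdens_meas _ _ _
  have hos : ∀ t, osLaw n unif (idx t) = volume.withDensity (f t) := fun t => osLaw_dens n (idx t)
  haveI : ∀ t, SigmaFinite (volume.withDensity (f t)) := fun t => by
    rw [← hos t]; infer_instance
  set Q := Measure.pi fun t => osLaw n unif (idx t) with hQdef
  haveI hQp : IsProbabilityMeasure Q := by rw [hQdef]; infer_instance
  have hQ : Q = volume.withDensity q := by
    rw [hQdef]; simp_rw [hos]; exact pi_dens (k+1) f hfm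
  have hqm : Measurable q :=
    Finset.measurable_fun_prod _ fun t _ => (hfm t).comp (measurable_pi_apply t)
  have hpm : Measurable p := jdens_meas _ _ _
  set r : (Fin (k+1) → ℝ) → ENNReal := fun u => p u / q u with hr
  have hrm : Measurable r := hpm.div hqm
  -- real-valued densities
  set D : Fin (k+1) → ℝ → ℝ := fun t w => n.factorial * (w ^ (idx t : ℕ) / (idx t : ℕ).factorial *
    ((1 - w) ^ (n - idx t - 1) / (n - idx t - 1).factorial)) with hD
  have hDpos : ∀ u ∈ osS (k+1) 0, ∀ t, 0 < D t (u t) := by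
    intro u hu t
    have h1 := (hu.2 t).1
    have h2 := sub_pos.2 (hu.2 t).2
    simp only [hD]
    positivity
  have hqu : ∀ u ∈ osS (k+1) 0, q u = ENNReal.ofReal (∏ t, D t (u t)) := by
    intro u hu
    rw [ENNReal.ofReal_prod_of_nonneg fun t _ => (hDpos u hu t).le]
    refine Finset.prod_congr rfl fun t _ => ?_
    simp only [hf, bdens]
    rw [Set.indicator_of_mem (hu.2 t)]
  have hprod : p = q * r := by
    funext u
    simp only [Pi.mul_apply, hr]
    by_cases hu : u ∈ osS (k+1) 0
    · rw [ENNReal.mul_div_cancel]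
      · rw [hqu u hu]
        exact (ENNReal.ofReal_pos.2 (Finset.prod_pos fun t _ => hDpos u hu t)).ne'
      · rw [hqu u hu]; exact ENNReal.ofReal_ne_top
    · have : p u = 0 := Set.indicator_of_notMem hu _
      rw [this]; simp
  have hPQ : P = Q.withDensity r := by
    rw [hP, hQ, hprod, withDensity_mul _ hqm hrm]
  have hac : P ≪ Q := by rw [hPQ]; exact withDensity_absolutelyContinuous _ _
  rw [klDiv, if_pos hac]
  congr 1
  have hmem : ∀ᵐ u ∂P, u ∈ osS (k+1) 0 := by
    rw [hP, ae_withDensity_iff hpm]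
    refine Eventually.of_forall fun u hu => ?_
    by_contra h
    exact hu (Set.indicator_of_notMem h _)
  have hrn : P.rnDeriv Q =ᵐ[P] r := by
    apply hac.ae_eq
    conv_lhs => rw [hPQ]
    exact Measure.rnDeriv_withDensity Q hrm
  have hcongr : ∀ᵐ u ∂P, Real.log ((P.rnDeriv Q u).toReal) =
      Real.log n.factorial + ∑ t ∈ Finset.range (k+2),
        (g t * Real.log (osG (k+1) 0 u t) - Real.log (g t).factorial) -
      ∑ t : Fin (k+1), (Real.log n.factorial +
        ((idx t : ℕ) * Real.log (u t) - Real.log (idx t : ℕ).factorial) +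
        ((n - idx t - 1 : ℕ) * Real.log (1 - u t) - Real.log (n - idx t - 1).factorial)) := by
    filter_upwards [hmem, hrn] with u hu hru
    have hW := osW_pos (k+1) g 0 one_pos u hu
    have hpr : 0 < ∏ t, D t (u t) := Finset.prod_pos fun t _ => hDpos u hu t
    have hn : (0:ℝ) < n.factorial := by positivity
    rw [hru]
    simp only [hr]
    rw [hqu u hu, hp, jdens, Set.indicator_of_mem hu, ENNReal.toReal_div,
      ENNReal.toReal_ofReal (by positivity), ENNReal.toReal_ofReal hpr.le,
      Real.log_div (by positivity) hpr.ne', Real.log_mul hn.ne' hW.ne',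
      log_osW _ _ _ one_pos _ hu, Real.log_prod fun t _ => (hDpos u hu t).ne']
    congr 1
    refine Finset.sum_congr rfl fun t _ => ?_
    have h1 := (hu.2 t).1
    have h2 := sub_pos.2 (hu.2 t).2
    simp only [hD]
    rw [Real.log_mul hn.ne' (by positivity), Real.log_mul (by positivity) (by positivity),
      Real.log_div (by positivity) (by positivity), Real.log_div (by positivity) (by positivity),
      Real.log_pow, Real.log_pow, add_assoc]
  rw [integral_congr_ae hcongr]
  -- expectations of logs of gaps
  have hG : ∀ t ∈ Finset.range (k+2), Integrable (fun u => Real.log (osG (k+1) 0 u t)) P ∧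
      ∫ u, Real.log (osG (k+1) 0 u t) ∂P = (harmonic (g t) : ℝ) - harmonic n := by
    intro t ht
    have hle : g t ≤ ∑ s ∈ Finset.range (k+2), g s :=
      Finset.single_le_sum (f := g) (fun _ _ => Nat.zero_le _) ht
    have hlaw := jLaw_gap n k g idx hs hi t (n - g t - 1)
      (by have := Finset.mem_range.1 ht; omega) (by omega)
    have hb := bdens_log n (g t) (n - g t - 1) (by omega)
    rw [← hlaw] at hb
    have hm := (osG_meas (k+1) t 0)
    rw [integrable_map_measure Real.measurable_log.aestronglyMeasurable hm.aemeasurable,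
      integral_map hm.aemeasurable Real.measurable_log.aestronglyMeasurable] at hb
    exact hb
  have hU : ∀ t : Fin (k+1), Integrable (fun u : Fin (k+1) → ℝ => Real.log (u t)) P ∧
      ∫ u, Real.log (u t) ∂P = (harmonic (idx t) : ℝ) - harmonic n := by
    intro t
    have hb := bdens_log n (idx t) (n - idx t - 1) (by have := (idx t).isLt; omega)
    rw [← osLaw_dens, ← osLaw_eq n (k+1) idx t] at hb
    rw [integrable_map_measure Real.measurable_log.aestronglyMeasurable (measurable_pi_apply t).aemeasurable,
      integral_map (measurable_pi_apply t).aemeasurable Real.measurable_log.aestronglyMeasurable] at hb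
    exact hb
  have hV : ∀ t : Fin (k+1), Integrable (fun u : Fin (k+1) → ℝ => Real.log (1 - u t)) P ∧
      ∫ u, Real.log (1 - u t) ∂P = (harmonic (n - idx t - 1) : ℝ) - harmonic n := by
    intro t
    have hb := bdens_log' n (idx t) (n - idx t - 1) (by have := (idx t).isLt; omega)
    rw [← osLaw_dens, ← osLaw_eq n (k+1) idx t] at hb
    have hm : Measurable fun w : ℝ => Real.log (1 - w) := by fun_prop
    rw [integrable_map_measure hm.aestronglyMeasurable (measurable_pi_apply t).aemeasurable,
      integral_map (measurable_pi_apply t).aemeasurable hm.aestronglyMeasurable] at hb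
    exact hb
  have i1 : ∀ t ∈ Finset.range (k+2), Integrable
      (fun u => g t * Real.log (osG (k+1) 0 u t) - Real.log (g t).factorial) P :=
    fun t ht => ((hG t ht).1.const_mul _).sub (integrable_const _)
  have i2 : ∀ t : Fin (k+1), Integrable (fun u : Fin (k+1) → ℝ =>
      ((idx t : ℕ) * Real.log (u t) - Real.log (idx t : ℕ).factorial)) P :=
    fun t => ((hU t).1.const_mul _).sub (integrable_const _)
  have i3 : ∀ t : Fin (k+1), Integrable (fun u : Fin (k+1) → ℝ =>
      ((n - idx t - 1 : ℕ) * Real.log (1 - u t) - Real.log (n - idx t - 1).factorial)) P :=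
    fun t => ((hV t).1.const_mul _).sub (integrable_const _)
  have i4 : ∀ t : Fin (k+1), Integrable (fun u : Fin (k+1) → ℝ => (Real.log n.factorial +
        ((idx t : ℕ) * Real.log (u t) - Real.log (idx t : ℕ).factorial) +
        ((n - idx t - 1 : ℕ) * Real.log (1 - u t) - Real.log (n - idx t - 1).factorial))) P :=
    fun t => ((integrable_const _).add (i2 t)).add (i3 t)
  have iS1 := integrable_finsetSum _ i1
  have iS2 := integrable_finsetSum Finset.univ fun t _ => i4 t
  have iA : Integrable (fun u => Real.log n.factorial + ∑ t ∈ Finset.range (k+2),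
      (g t * Real.log (osG (k+1) 0 u t) - Real.log (g t).factorial)) P :=
    (integrable_const _).add iS1
  have i5 : ∀ t : Fin (k+1), Integrable (fun u : Fin (k+1) → ℝ => (Real.log n.factorial +
        ((idx t : ℕ) * Real.log (u t) - Real.log (idx t : ℕ).factorial))) P :=
    fun t => (integrable_const _).add (i2 t)
  rw [integral_sub iA iS2, integral_add (integrable_const _) iS1,
    integral_finsetSum _ i1, integral_finsetSum _ fun t _ => i4 t]
  congr 1
  · congr 1
    · simp
    · refine Finset.sum_congr rfl fun t ht => ?_
      rw [integral_sub ((hG t ht).1.const_mul _) (integrable_const _), integral_const_mul,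
        (hG t ht).2]
      simp
  · refine Finset.sum_congr rfl fun t _ => ?_
    rw [integral_add (i5 t) (i3 t),
      integral_add (integrable_const _) (i2 t),
      integral_sub ((hU t).1.const_mul _) (integrable_const _),
      integral_sub ((hV t).1.const_mul _) (integrable_const _),
      integral_const_mul, integral_const_mul, (hU t).2, (hV t).2]
    simp

lemma idx_sum (n k : ℕ) (i : ℕ → ℕ)
    (hmono : StrictMonoOn i (Set.Icc 1 (k+1)))
    (hbdd : ∀ t ∈ Set.Icc 1 (k+1), 1 ≤ i t ∧ i t ≤ n) (g : ℕ → ℕ)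
    (h0 : g 0 = i 1 - 1) (h1 : ∀ t, t < k → g (t+1) = i (t+2) - i (t+1) - 1)
    (t : ℕ) (ht : t ≤ k) : i (t+1) - 1 = ∑ s ∈ Finset.range (t+1), g s + t := by
  induction t with
  | zero => simp [h0]
  | succ t ih =>
    have ih := ih (by omega)
    rw [Finset.sum_range_succ, h1 t (by omega)]
    have a := hmono (a := t+1) (b := t+2) ⟨by omega, by omega⟩ ⟨by omega, by omega⟩ (by omega)
    have b := (hbdd (t+1) ⟨by omega, by omega⟩).1
    show i (t+2) - 1 = _
    omega

lemma icc_sum (a k : ℕ) (f : ℕ → ℝ) :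
    ∑ t ∈ Finset.Icc (a+1) (k+a), f t = ∑ t ∈ Finset.range k, f (t+a+1) := by
  induction k with
  | zero => simp
  | succ k ih =>
    rw [show k+1+a = k+a+1 by ring, Finset.sum_Icc_succ_top (by omega), ih, Finset.sum_range_succ]

lemma final_alg (n k : ℕ) (i : ℕ → ℕ) (g : ℕ → ℕ)
    (hbdd : ∀ t ∈ Set.Icc 1 (k+1), 1 ≤ i t ∧ i t ≤ n)
    (h0 : g 0 = i 1 - 1) (h1 : ∀ t, t < k → g (t+1) = i (t+2) - i (t+1) - 1)
    (h2 : g (k+1) = n - i (k+1))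
    (hs : ∑ t ∈ Finset.range (k+2), g t + (k + 1) = n) :
    (Real.log n.factorial + ∑ t ∈ Finset.range (k+2), (g t * ((harmonic (g t) : ℝ) - harmonic n)
        - Real.log (g t).factorial) -
      ∑ t : Fin (k+1), (Real.log n.factorial +
        ((i (t.1+1) - 1 : ℕ) * ((harmonic (i (t.1+1) - 1) : ℝ) - harmonic n)
          - Real.log (i (t.1+1) - 1 : ℕ).factorial) +
        ((n - (i (t.1+1) - 1) - 1 : ℕ) * ((harmonic (n - (i (t.1+1) - 1) - 1) : ℝ) - harmonic n)
          - Real.log (n - (i (t.1+1) - 1) - 1).factorial)) : ℝ)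
    = (∑ t ∈ Finset.Icc 2 (k+1), (T (i t - 1) - T (i t - i (t - 1) - 1)))
          + (∑ t ∈ Finset.Icc 1 (k+1 - 1), T (n - i t)) - (((k+1 : ℕ) : ℝ) - 1) * T n := by
  have e1 : ∑ t ∈ Finset.range (k+2), (g t * ((harmonic (g t) : ℝ) - harmonic n)
        - Real.log (g t).factorial) = - ∑ t ∈ Finset.range (k+2), T (g t)
          - ((n:ℝ) - (k+1)) * harmonic n := by
    have : ((n:ℝ) - (k+1)) = ∑ t ∈ Finset.range (k+2), (g t : ℝ) := by
      rw [← hs]; push_cast; ring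
    rw [this, Finset.sum_mul, ← Finset.sum_neg_distrib, ← Finset.sum_sub_distrib]
    refine Finset.sum_congr rfl fun t _ => ?_
    unfold T; ring
  have e2 : ∑ t : Fin (k+1), (Real.log n.factorial +
        ((i (t.1+1) - 1 : ℕ) * ((harmonic (i (t.1+1) - 1) : ℝ) - harmonic n)
          - Real.log (i (t.1+1) - 1 : ℕ).factorial) +
        ((n - (i (t.1+1) - 1) - 1 : ℕ) * ((harmonic (n - (i (t.1+1) - 1) - 1) : ℝ) - harmonic n)
          - Real.log (n - (i (t.1+1) - 1) - 1).factorial))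
      = (k+1) * (Real.log n.factorial - ((n:ℝ) - 1) * harmonic n)
        - ∑ t ∈ Finset.range (k+1), T (i (t+1) - 1) - ∑ t ∈ Finset.range (k+1), T (n - i (t+1)) := by
    rw [← Fin.sum_univ_eq_sum_range (fun t => T (i (t+1) - 1)),
      ← Fin.sum_univ_eq_sum_range (fun t => T (n - i (t+1)))]
    have : ((k:ℝ)+1) * (Real.log n.factorial - ((n:ℝ) - 1) * harmonic n)
      = ∑ _t : Fin (k+1), (Real.log n.factorial - ((n:ℝ) - 1) * harmonic n) := by
      simp
      ring
    rw [this, ← Finset.sum_sub_distrib, ← Finset.sum_sub_distrib]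
    refine Finset.sum_congr rfl fun t _ => ?_
    obtain ⟨ha, hb⟩ := hbdd (t.1+1) ⟨by omega, by have := t.isLt; omega⟩
    rw [show n - (i (t.1+1) - 1) - 1 = n - i (t.1+1) by omega]
    unfold T
    push_cast [ha, hb]
    ring
  rw [e1, e2, icc_sum 1 k, Nat.add_sub_cancel, show k = k + 0 from rfl, icc_sum 0 (k+0),
    Finset.sum_range_succ, Finset.sum_range_succ' (fun t => T (g t)),
    Finset.sum_range_succ' (fun t => T (i (t+1) - 1)),
    Finset.sum_range_succ (fun t => T (n - i (t+1))), Finset.sum_sub_distrib]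
  simp only [Nat.add_zero] at *
  have e3 : ∑ t ∈ Finset.range k, T (g (t+1)) =
      ∑ t ∈ Finset.range k, T (i (t+1+1) - i (t+1+1-1) - 1) := by
    refine Finset.sum_congr rfl fun t ht => ?_
    rw [h1 t (Finset.mem_range.1 ht)]
    rfl
  rw [e3, h0, h2]
  have e4 : T n = Real.log n.factorial - n * (harmonic n : ℝ) := rfl
  rw [e4]
  push_cast
  ring

/-- KL divergence between the joint law of the uniform order statistics indexed by
`i_1 < i_2 < ... < i_k` (1-based indexing) and the product of their marginal laws. -/
theorem kl_uniform_orderStatistics_subset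
    (n k : ℕ) (hk : 1 ≤ k) (i : ℕ → ℕ)
    (hmono : StrictMonoOn i (Set.Icc 1 k))
    (hbdd : ∀ t ∈ Set.Icc 1 k, 1 ≤ i t ∧ i t ≤ n) :
    klDiv
      ((sampleLaw n unif).map fun x (t : Fin k) =>
        sortTuple x ⟨i (t.1 + 1) - 1, by
          have h := hbdd (t.1 + 1) ⟨by omega, by have := t.isLt; omega⟩; omega⟩)
      (Measure.pi fun t : Fin k =>
        osLaw n unif ⟨i (t.1 + 1) - 1, by
          have h := hbdd (t.1 + 1) ⟨by omega, by have := t.isLt; omega⟩; omega⟩)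
      = (((∑ t ∈ Finset.Icc 2 k, (T (i t - 1) - T (i t - i (t - 1) - 1)))
          + (∑ t ∈ Finset.Icc 1 (k - 1), T (n - i t)) - ((k : ℝ) - 1) * T n : ℝ) : EReal) := by
  obtain ⟨k, rfl⟩ : ∃ k', k = k' + 1 := ⟨k - 1, by omega⟩
  set g : ℕ → ℕ := fun t => if t = 0 then i 1 - 1 else if t < k + 1 then i (t+1) - i t - 1
    else n - i (k+1) with hg
  have h0 : g 0 = i 1 - 1 := by simp [hg]
  have h1 : ∀ t, t < k → g (t+1) = i (t+2) - i (t+1) - 1 := by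
    intro t ht
    simp [hg, ht]
  have h2 : g (k+1) = n - i (k+1) := by simp [hg]
  have hsum := idx_sum n k i hmono hbdd g h0 h1
  have hs : ∑ t ∈ Finset.range (k+2), g t + (k + 1) = n := by
    have := hsum k le_rfl
    have hb := hbdd (k+1) ⟨by omega, le_rfl⟩
    rw [Finset.sum_range_succ, h2]
    omega
  rw [← final_alg n k i g hbdd h0 h1 h2 hs]
  exact main_gen n k g (fun t : Fin (k+1) => ⟨i (t.1 + 1) - 1, by
    have h := hbdd (t.1 + 1) ⟨by omega, by have := t.isLt; omega⟩; omega⟩) hs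
    (fun t => hsum t (by have := t.isLt; omega))
end
end
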